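/- arXiv:2605.25028 — 6 statements merged into one kernel-verified Lean document; each statement's English description precedes it below -/
import Mathlib

section
/- Let n ≥ 2 and k = 2^n. For every ℓ ∈ {0,…,k−1} there exists a unique binary vector b ∈ {0,1}^n such that R^{b_n} R_n ⋯ R^{b_1} R_1 v_ℓ = v_0, where R^{0} is the identity matrix and R^{1} = R. -/
open Real MeasureTheory Matrix

/-- The clockwise rotation matrix by angle `π / 2 ^ j` (this is `R_{j+1}` in 1-based indexing). -/
noncomputable def rotM (j : ℕ) : Matrix (Fin 2) (Fin 2) ℝ :=
  !![Real.cos (Real.pi / 2 ^ j), Real.sin (Real.pi / 2 ^ j);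
     -Real.sin (Real.pi / 2 ^ j), Real.cos (Real.pi / 2 ^ j)]

/-- The reflection with respect to the first axis. -/
def reflM : Matrix (Fin 2) (Fin 2) ℝ := !![1, 0; 0, -1]

/-- The vertex `v_ℓ = sec(π/2^n) (cos((2ℓ+1)π/2^n), sin((2ℓ+1)π/2^n))` of the regular `2^n`-gon. -/
noncomputable def vtx (n ℓ : ℕ) : Fin 2 → ℝ :=
  (Real.cos (Real.pi / 2 ^ n))⁻¹ •
    ![Real.cos ((2 * ℓ + 1) * Real.pi / 2 ^ n), Real.sin ((2 * ℓ + 1) * Real.pi / 2 ^ n)]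

/-- The facet midpoint `w_ℓ = (cos((2ℓ+2)π/2^n), sin((2ℓ+2)π/2^n))`. -/
noncomputable def wpt (n ℓ : ℕ) : Fin 2 → ℝ :=
  ![Real.cos ((2 * ℓ + 2) * Real.pi / 2 ^ n), Real.sin ((2 * ℓ + 2) * Real.pi / 2 ^ n)]

/-- `chainAux n b x i = R^{b_i} R_i ⋯ R^{b_1} R_1 x` (1-based indexing of `b` and `R`). -/
noncomputable def chainAux (n : ℕ) (b : Fin n → Fin 2) (x : Fin 2 → ℝ) : ℕ → Fin 2 → ℝ
  | 0 => x
  | i + 1 =>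
    if h : i < n then
      (reflM ^ ((b ⟨i, h⟩ : Fin 2) : ℕ)) *ᵥ (rotM i *ᵥ chainAux n b x i)
    else chainAux n b x i

/-- The point at angle `a * π / 2 ^ n` on the circle through the vertices `vtx n ℓ`. -/
noncomputable def circlePoint (n : ℕ) (a : ℤ) : Fin 2 → ℝ :=
  (Real.cos (Real.pi / 2 ^ n))⁻¹ •
    ![Real.cos (a * Real.pi / 2 ^ n), Real.sin (a * Real.pi / 2 ^ n)]

theorem vtx_eq_circlePoint (n ℓ : ℕ) : vtx n ℓ = circlePoint n (2 * ℓ + 1) := by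
  simp [vtx, circlePoint]

theorem rotM_mulVec_circlePoint {n i : ℕ} (hi : i ≤ n) (a : ℤ) :
    rotM i *ᵥ circlePoint n a = circlePoint n (a - 2 ^ (n - i)) := by
  have h : ((a - 2 ^ (n - i) : ℤ) : ℝ) * Real.pi / 2 ^ n
      = a * Real.pi / 2 ^ n - Real.pi / 2 ^ i := by
    obtain ⟨d, rfl⟩ := Nat.exists_eq_add_of_le hi
    rw [Nat.add_sub_cancel_left, pow_add]
    push_cast
    field_simp
  rw [circlePoint, circlePoint, h, Real.cos_sub, Real.sin_sub, mulVec_smul]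
  congr 1
  ext j
  fin_cases j <;> simp [rotM, mulVec, dotProduct, Fin.sum_univ_two] <;> ring

theorem reflM_mulVec_circlePoint (n : ℕ) (a : ℤ) :
    reflM *ᵥ circlePoint n a = circlePoint n (-a) := by
  ext j
  fin_cases j <;>
    simp [reflM, circlePoint, mulVec, dotProduct, Fin.sum_univ_two, neg_mul, neg_div]

theorem vtx_injOn {n : ℕ} (hn : 2 ≤ n) {ℓ m : ℕ} (hℓ : ℓ < 2 ^ n) (hm : m < 2 ^ n)
    (h : vtx n ℓ = vtx n m) : ℓ = m := by
  have hcos : Real.cos (Real.pi / 2 ^ n) ≠ 0 := by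
    have h4 : (4 : ℝ) ≤ 2 ^ n := by
      calc (4 : ℝ) = 2 ^ 2 := by norm_num
        _ ≤ 2 ^ n := pow_le_pow_right₀ (by norm_num) hn
    refine (Real.cos_pos_of_mem_Ioo ⟨?_, ?_⟩).ne'
    · have : 0 < Real.pi / 2 ^ n := by positivity
      linarith [Real.pi_pos]
    · exact div_lt_div_of_pos_left Real.pi_pos (by norm_num) (by linarith)
  have h' := smul_right_injective (Fin 2 → ℝ) (inv_ne_zero hcos) h
  have hc := congrFun h' 0
  have hs := congrFun h' 1
  simp only [Matrix.cons_val_zero, Matrix.cons_val_one] at hc hs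
  obtain ⟨z, hz⟩ := Real.Angle.angle_eq_iff_two_pi_dvd_sub.1 (Real.Angle.cos_sin_inj hc hs)
  have hz' : (ℓ : ℤ) - m = 2 ^ n * z := by
    have : (ℓ : ℝ) - m = 2 ^ n * z := by
      field_simp at hz
      linarith
    exact_mod_cast this
  have hz0 : (ℓ : ℤ) - m = 0 := by
    refine Int.eq_zero_of_abs_lt_dvd ⟨z, hz'⟩ ?_
    have hℓ' : (ℓ : ℤ) < 2 ^ n := by exact_mod_cast hℓ
    have hm' : (m : ℤ) < 2 ^ n := by exact_mod_cast hm
    rw [abs_lt]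
    constructor <;> linarith [Int.natCast_nonneg ℓ, Int.natCast_nonneg m]
  omega

theorem isUnit_rotM (j : ℕ) : IsUnit (rotM j) := by
  rw [Matrix.isUnit_iff_isUnit_det]
  have : (rotM j).det = 1 := by
    simp [rotM, Matrix.det_fin_two_of, ← pow_two]
  simp [this]

theorem isUnit_reflM : IsUnit reflM := by
  rw [Matrix.isUnit_iff_isUnit_det]
  simp [reflM, Matrix.det_fin_two_of]

theorem chainAux_injective (n : ℕ) (b : Fin n → Fin 2) (i : ℕ) :
    Function.Injective fun x => chainAux n b x i := by
  induction i with
  | zero => exact fun _ _ h => h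
  | succ i ih =>
    intro x y h
    simp only [chainAux] at h
    split_ifs at h with hi
    · exact ih (Matrix.mulVec_injective_of_isUnit (isUnit_rotM i)
        (Matrix.mulVec_injective_of_isUnit (isUnit_reflM.pow _) h))
    · exact ih h

/-- The angles, in units of `π / 2 ^ n`, obtained by reflecting into the upper half-plane after
each rotation. -/
def foldedAngle (n : ℕ) (a : ℤ) : ℕ → ℤ
  | 0 => a
  | i + 1 => |foldedAngle n a i - 2 ^ (n - i)|

theorem foldedAngle_bounds (n : ℕ) {a : ℤ} (ha : Odd a) (h0 : 0 < a) (h1 : a < 2 ^ (n + 1))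
    {i : ℕ} (hi : i ≤ n) :
    Odd (foldedAngle n a i) ∧ 0 < foldedAngle n a i ∧ foldedAngle n a i < 2 ^ (n - i + 1) := by
  induction i with
  | zero => exact ⟨ha, h0, h1⟩
  | succ i ih =>
    obtain ⟨hodd, hpos, hlt⟩ := ih (by omega)
    have hodd' : Odd (foldedAngle n a (i + 1)) := by
      rw [foldedAngle]
      exact odd_abs.2 (hodd.sub_even (even_two.pow_of_ne_zero (by omega)))
    refine ⟨hodd', lt_of_le_of_ne (abs_nonneg _) fun h => ?_, ?_⟩
    · rw [← h] at hodd'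
      exact absurd hodd' (by decide)
    · rw [pow_succ] at hlt
      rw [foldedAngle, show n - (i + 1) + 1 = n - i by omega, abs_lt]
      constructor <;> linarith

theorem chainAux_foldedAngle (n : ℕ) (a : ℤ) {i : ℕ} (hi : i ≤ n) :
    chainAux n (fun j => if foldedAngle n a j - 2 ^ (n - j) < 0 then 1 else 0)
      (circlePoint n a) i = circlePoint n (foldedAngle n a i) := by
  induction i with
  | zero => rfl
  | succ i ih =>
    rw [chainAux, dif_pos (by omega), ih (by omega), rotM_mulVec_circlePoint (by omega),
      foldedAngle]
    dsimp only
    split_ifs with h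
    · rw [Fin.val_one, pow_one, reflM_mulVec_circlePoint, abs_of_neg h]
    · simp [abs_of_nonneg (not_lt.1 h)]

theorem exists_chainAux_vtx_eq {n ℓ : ℕ} (hℓ : ℓ < 2 ^ n) :
    ∃ b : Fin n → Fin 2, chainAux n b (vtx n ℓ) n = vtx n 0 := by
  refine ⟨_, (vtx_eq_circlePoint n ℓ) ▸ chainAux_foldedAngle n (2 * ℓ + 1) le_rfl |>.trans ?_⟩
  have hℓ' : (ℓ : ℤ) < 2 ^ n := by exact_mod_cast hℓ
  obtain ⟨-, h0, h1⟩ := foldedAngle_bounds n (a := 2 * ℓ + 1) ⟨ℓ, rfl⟩ (by omega)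
    (by rw [pow_succ]; omega) le_rfl
  rw [Nat.sub_self, zero_add, pow_one] at h1
  rw [vtx_eq_circlePoint]
  congr 1
  push_cast
  omega

/-- For each vertex `v_ℓ` of `Q_{2^n}` there is a unique binary vector `b ∈ {0,1}^n` with
`R^{b_n} R_n ⋯ R^{b_1} R_1 v_ℓ = v_0`. -/
theorem unique_binary_vector (n : ℕ) (hn : 2 ≤ n) (ℓ : ℕ) (hℓ : ℓ < 2 ^ n) :
    ∃! b : Fin n → Fin 2, chainAux n b (vtx n ℓ) n = vtx n 0 := by
  choose f hf using fun m : Fin (2 ^ n) => exists_chainAux_vtx_eq m.isLt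
  have heq {b : Fin n → Fin 2} {l m : Fin (2 ^ n)} (hl : chainAux n b (vtx n l) n = vtx n 0)
      (hm : chainAux n b (vtx n m) n = vtx n 0) : l = m :=
    Fin.ext (vtx_injOn hn l.isLt m.isLt (chainAux_injective n b n (hl.trans hm.symm)))
  have hinj : Function.Injective f := fun l m h => heq (hf l) (h ▸ hf m)
  have hsurj := ((Fintype.bijective_iff_injective_and_card f).2 ⟨hinj, by simp⟩).2
  refine ⟨f ⟨ℓ, hℓ⟩, hf ⟨ℓ, hℓ⟩, fun b hb => ?_⟩
  obtain ⟨m, rfl⟩ := hsurj b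
  rw [heq (l := ⟨ℓ, hℓ⟩) hb (hf m)]
end

section
/- Let n ≥ 2, k = 2^n, and ℓ ∈ {0,…,k−1}. Define b ∈ {0,1}^n recursively for i = 1,…,n by b_i := 1 if the second entry of R_i R^{b_{i−1}} R_{i−1} ⋯ R^{b_1} R_1 v_ℓ is negative and b_i := 0 otherwise. Then for every i ∈ {1,…,n} the vector R^{b_i} R_i ⋯ R^{b_1} R_1 v_ℓ is a nonzero vector whose polar angle lies in the interval [0, π/2^{i−1}], and R^{b_n} R_n ⋯ R^{b_1} R_1 v_ℓ = v_0. -/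
open Real MeasureTheory Matrix

/-- The vector of length `c` and polar angle `θ`. -/
noncomputable def polarVec (c θ : ℝ) : Fin 2 → ℝ := c • ![Real.cos θ, Real.sin θ]

theorem rotM_mulVec_polarVec (j : ℕ) (c θ : ℝ) :
    rotM j *ᵥ polarVec c θ = polarVec c (θ - Real.pi / 2 ^ j) := by
  ext i
  fin_cases i <;>
    simp [rotM, polarVec, Matrix.mulVec, dotProduct, Fin.sum_univ_two, Real.cos_sub,
      Real.sin_sub] <;> ring

theorem reflM_mulVec_polarVec (c θ : ℝ) : reflM *ᵥ polarVec c θ = polarVec c (-θ) := by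
  ext i
  fin_cases i <;> simp [reflM, polarVec, Matrix.mulVec, dotProduct, Fin.sum_univ_two]

/-- Reflecting exactly when the second entry is negative replaces the angle by its modulus. -/
theorem reflM_pow_mulVec_polarVec {c θ : ℝ} (hc : 0 < c) (hθ : |θ| < Real.pi) (β : Fin 2)
    (hβ : β = 1 ↔ polarVec c θ 1 < 0) :
    (reflM ^ (β : ℕ)) *ᵥ polarVec c θ = polarVec c |θ| := by
  have hentry : polarVec c θ 1 = c * Real.sin θ := by simp [polarVec]
  obtain ⟨hlo, hhi⟩ := abs_lt.mp hθ
  rcases lt_or_ge θ 0 with h | h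
  · have hone : β = 1 := hβ.mpr <| by
      rw [hentry]
      exact mul_neg_of_pos_of_neg hc (Real.sin_neg_of_neg_of_neg_pi_lt h hlo)
    rw [hone, abs_of_neg h]
    simpa using reflM_mulVec_polarVec c θ
  · have hzero : β = 0 := by
      have hne : β ≠ 1 := fun e => absurd (hβ.mp e) <| by
        rw [hentry, not_lt]
        exact mul_nonneg hc.le (Real.sin_nonneg_of_nonneg_of_le_pi h hhi.le)
      omega
    rw [hzero, abs_of_nonneg h]
    simp

theorem polarVec_ne_zero {c : ℝ} (hc : 0 < c) (θ : ℝ) : polarVec c θ ≠ 0 := by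
  intro h
  have h0 := congrFun h 0
  have h1 := congrFun h 1
  simp only [polarVec, Pi.smul_apply, Matrix.cons_val_zero, Matrix.cons_val_one, smul_eq_mul,
    Pi.zero_apply, mul_eq_zero, hc.ne', false_or] at h0 h1
  simpa [h0, h1] using Real.sin_sq_add_cos_sq θ

theorem arg_polarVec {c θ : ℝ} (hc : 0 < c) (hθ : θ ∈ Set.Ioc (-Real.pi) Real.pi) :
    Complex.arg ((polarVec c θ 0 : ℂ) + (polarVec c θ 1 : ℂ) * Complex.I) = θ := by
  convert Complex.arg_mul_cos_add_sin_mul_I hc hθ using 2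
  simp [polarVec]
  ring

theorem vtx_eq_polarVec (n ℓ : ℕ) :
    vtx n ℓ = polarVec (Real.cos (Real.pi / 2 ^ n))⁻¹ ((2 * ℓ + 1 : ℤ) * (Real.pi / 2 ^ n)) := by
  simp [vtx, polarVec, mul_div_assoc]

/-- After `i` steps the angle is an odd multiple `m * (π / 2 ^ n)` with `0 < m < 2 ^ (n + 1 - i)`. -/
theorem exists_chainAux_eq_polarVec {n ℓ : ℕ} (hℓ : ℓ < 2 ^ n)
    (b : Fin n → Fin 2)
    (hb : ∀ i : Fin n, b i = 1 ↔ (rotM i *ᵥ chainAux n b (vtx n ℓ) i) 1 < 0)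
    (hc : 0 < (Real.cos (Real.pi / 2 ^ n))⁻¹) (i : ℕ) (hi : i ≤ n) :
    ∃ m : ℤ, Odd m ∧ 0 < m ∧ m < 2 ^ (n + 1 - i) ∧
      chainAux n b (vtx n ℓ) i =
        polarVec (Real.cos (Real.pi / 2 ^ n))⁻¹ (m * (Real.pi / 2 ^ n)) := by
  induction i with
  | zero =>
    refine ⟨2 * ℓ + 1, ⟨ℓ, rfl⟩, by positivity, ?_, by
      simpa [chainAux] using vtx_eq_polarVec n ℓ⟩
    have : (ℓ : ℤ) < 2 ^ n := by exact_mod_cast hℓ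
    rw [Nat.sub_zero, pow_succ]
    omega
  | succ i ih =>
    obtain ⟨m, hodd, hpos, hlt, hm⟩ := ih (by omega)
    have hin : i < n := hi
    have hstep : n + 1 - i = (n - i) + 1 := by omega
    rw [hstep, pow_succ] at hlt
    have heven : Even ((2 : ℤ) ^ (n - i)) :=
      even_two.pow_of_ne_zero (by omega)
    have hodd' : Odd (m - 2 ^ (n - i)) := hodd.sub_even heven
    have habs : |m - 2 ^ (n - i)| < 2 ^ (n - i) := by
      rw [abs_lt]; constructor <;> linarith
    have hangle : (m : ℝ) * (Real.pi / 2 ^ n) - Real.pi / 2 ^ i =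
        ((m - 2 ^ (n - i) : ℤ) : ℝ) * (Real.pi / 2 ^ n) := by
      have hsplit : (2 : ℝ) ^ n = 2 ^ (n - i) * 2 ^ i := by
        rw [← pow_add, Nat.sub_add_cancel hin.le]
      push_cast
      rw [hsplit]
      field_simp
    have hunit : 0 < Real.pi / 2 ^ n := by positivity
    have habs_pi : |((m - 2 ^ (n - i) : ℤ) : ℝ) * (Real.pi / 2 ^ n)| < Real.pi := by
      rw [abs_mul, abs_of_pos hunit, ← Int.cast_abs]
      have hle : (2 : ℤ) ^ (n - i) ≤ 2 ^ n := pow_le_pow_right₀ (by norm_num) (by omega)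
      have hreal : ((|m - 2 ^ (n - i)| : ℤ) : ℝ) < 2 ^ n := by
        exact_mod_cast habs.trans_le hle
      calc _ < (2 : ℝ) ^ n * (Real.pi / 2 ^ n) := mul_lt_mul_of_pos_right hreal hunit
        _ = Real.pi := by field_simp
    refine ⟨|m - 2 ^ (n - i)|, odd_abs.mpr hodd', ?_, ?_, ?_⟩
    · exact abs_pos.mpr fun h => by simp [h] at hodd'
    · rwa [Nat.add_sub_add_right]
    · have hbi := hb ⟨i, hin⟩
      simp only [hm, rotM_mulVec_polarVec, hangle] at hbi
      rw [chainAux, dif_pos hin, hm, rotM_mulVec_polarVec, hangle,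
        reflM_pow_mulVec_polarVec hc habs_pi _ hbi, abs_mul, abs_of_pos hunit, Int.cast_abs]

/-- If `b` is defined recursively by `b_i = 1` iff the second entry of
`R_i R^{b_{i-1}} R_{i-1} ⋯ R^{b_1} R_1 v_ℓ` is negative, then each partial product
`R^{b_i} R_i ⋯ R^{b_1} R_1 v_ℓ` is a nonzero vector with polar angle in `[0, π/2^{i-1}]`,
and the final vector equals `v_0`. -/
theorem recursive_b_angles (n : ℕ) (hn : 2 ≤ n) (ℓ : ℕ) (hℓ : ℓ < 2 ^ n)
    (b : Fin n → Fin 2)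
    (hb : ∀ i : Fin n, b i = 1 ↔ (rotM i *ᵥ chainAux n b (vtx n ℓ) i) 1 < 0) :
    (∀ i : Fin n,
      chainAux n b (vtx n ℓ) (i + 1) ≠ 0 ∧
      Complex.arg ((chainAux n b (vtx n ℓ) (i + 1) 0 : ℂ)
          + (chainAux n b (vtx n ℓ) (i + 1) 1 : ℂ) * Complex.I)
        ∈ Set.Icc 0 (Real.pi / 2 ^ (i : ℕ))) ∧
    chainAux n b (vtx n ℓ) n = vtx n 0 := by
  have hc : 0 < (Real.cos (Real.pi / 2 ^ n))⁻¹ := by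
    refine inv_pos.mpr (Real.cos_pos_of_mem_Ioo ⟨?_, ?_⟩)
    · have : 0 < Real.pi / 2 ^ n := by positivity
      linarith [Real.pi_pos]
    · refine div_lt_div_of_pos_left Real.pi_pos two_pos ?_
      simpa using pow_lt_pow_right₀ (one_lt_two : (1 : ℝ) < 2) (show 1 < n by omega)
  refine ⟨fun i => ?_, ?_⟩
  · obtain ⟨m, -, hpos, hlt, hm⟩ := exists_chainAux_eq_polarVec hℓ b hb hc (i + 1) i.2
    have hnonneg : 0 ≤ (m : ℝ) * (Real.pi / 2 ^ n) := by
      have : (0 : ℝ) < m := by exact_mod_cast hpos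
      positivity
    have hle : (m : ℝ) * (Real.pi / 2 ^ n) ≤ Real.pi / 2 ^ (i : ℕ) := by
      rw [Nat.add_sub_add_right] at hlt
      have hreal : (m : ℝ) ≤ 2 ^ (n - (i : ℕ)) := by exact_mod_cast hlt.le
      have hsplit : (2 : ℝ) ^ n = 2 ^ (n - (i : ℕ)) * 2 ^ (i : ℕ) := by
        rw [← pow_add, Nat.sub_add_cancel i.2.le]
      calc _ ≤ (2 : ℝ) ^ (n - (i : ℕ)) * (Real.pi / 2 ^ n) := by gcongr
        _ = Real.pi / 2 ^ (i : ℕ) := by rw [hsplit]; field_simp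
    have hle_pi : Real.pi / 2 ^ (i : ℕ) ≤ Real.pi :=
      div_le_self Real.pi_pos.le (one_le_pow₀ one_le_two)
    rw [hm, arg_polarVec hc ⟨by linarith [Real.pi_pos], hle.trans hle_pi⟩]
    exact ⟨polarVec_ne_zero hc _, hnonneg, hle⟩
  · obtain ⟨m, -, hpos, hlt, hm⟩ := exists_chainAux_eq_polarVec hℓ b hb hc n le_rfl
    have hone : m = 1 := by
      rw [Nat.add_sub_cancel_left] at hlt
      omega
    rw [hm, vtx_eq_polarVec, hone]
    simp
end

section
/- Let n ≥ 2. The projection of P^∅_n onto the coordinates (y_1, z_1) equals Q_{2^n}, the convex hull of the points v_0,…,v_{2^n−1}. -/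
open Real MeasureTheory Matrix

/-- The polyhedron `P^∅_n` in the space of pairs `(y, z)` (0-based: `y i` is `y_{i+1}`). -/
def Pempty (n : ℕ) : Set ((Fin (n + 1) → ℝ) × (Fin (n + 1) → ℝ)) :=
  {p | (∀ i : Fin n,
        p.1 i.succ = Real.cos (Real.pi / 2 ^ (i : ℕ)) * p.1 i.castSucc
            + Real.sin (Real.pi / 2 ^ (i : ℕ)) * p.2 i.castSucc ∧
        p.2 i.succ ≥ -Real.sin (Real.pi / 2 ^ (i : ℕ)) * p.1 i.castSucc
            + Real.cos (Real.pi / 2 ^ (i : ℕ)) * p.2 i.castSucc ∧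
        p.2 i.succ ≥ Real.sin (Real.pi / 2 ^ (i : ℕ)) * p.1 i.castSucc
            - Real.cos (Real.pi / 2 ^ (i : ℕ)) * p.2 i.castSucc) ∧
    p.1 (Fin.last n) ≤ 1 ∧
    Real.cos (Real.pi / 2 ^ (n - 1)) * p.1 (Fin.last n)
        + Real.sin (Real.pi / 2 ^ (n - 1)) * p.2 (Fin.last n) ≤ 1}

/-- The polyhedron `P^e_n` for an edge `e` (0-based indexing of `{1,…,n}` as `Fin n`). -/
def Pe (n : ℕ) (e : Finset (Fin n)) : Set ((Fin (n + 1) → ℝ) × (Fin (n + 1) → ℝ)) :=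
  {p | (∀ i : Fin n,
        p.1 i.succ = Real.cos (Real.pi / 2 ^ (i : ℕ)) * p.1 i.castSucc
            + Real.sin (Real.pi / 2 ^ (i : ℕ)) * p.2 i.castSucc ∧
        (if i ∈ e then
          p.2 i.succ = -Real.sin (Real.pi / 2 ^ (i : ℕ)) * p.1 i.castSucc
              + Real.cos (Real.pi / 2 ^ (i : ℕ)) * p.2 i.castSucc
        else
          p.2 i.succ ≥ -Real.sin (Real.pi / 2 ^ (i : ℕ)) * p.1 i.castSucc
              + Real.cos (Real.pi / 2 ^ (i : ℕ)) * p.2 i.castSucc ∧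
          p.2 i.succ ≥ Real.sin (Real.pi / 2 ^ (i : ℕ)) * p.1 i.castSucc
              - Real.cos (Real.pi / 2 ^ (i : ℕ)) * p.2 i.castSucc)) ∧
    Real.cos (Real.pi / 2 ^ n) * p.1 (Fin.last n)
        + Real.sin (Real.pi / 2 ^ n) * p.2 (Fin.last n) ≤ Real.cos (Real.pi / 2 ^ n)}

/-- Projection of a pair `(y, z)` to the coordinates `(y_1, z_1)`. -/
def proj2 {n : ℕ} (p : (Fin (n + 1) → ℝ) × (Fin (n + 1) → ℝ)) : Fin 2 → ℝ :=
  ![p.1 0, p.2 0]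

/-- The regular `2^n`-gon `Q_{2^n}`, as the convex hull of its vertices. -/
def Qgon (n : ℕ) : Set (Fin 2 → ℝ) :=
  convexHull ℝ {x | ∃ ℓ < 2 ^ n, x = vtx n ℓ}

/-- The triangle `Δ_ℓ` spanned by `w_{ℓ-1}`, `v_ℓ` and `w_ℓ` (indices mod `2^n`). -/
def tri (n ℓ : ℕ) : Set (Fin 2 → ℝ) :=
  convexHull ℝ {wpt n (ℓ + 2 ^ n - 1), vtx n ℓ, wpt n ℓ}


/-- The linear form `⟨(cos t, sin t), (y, z)⟩`. -/
noncomputable def dirForm (t y z : ℝ) : ℝ := Real.cos t * y + Real.sin t * z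

lemma dirForm_rotate (a t y z : ℝ) :
    dirForm t (dirForm a y z) (-Real.sin a * y + Real.cos a * z) = dirForm (a + t) y z := by
  simp only [dirForm, Real.cos_add, Real.sin_add]; ring

lemma dirForm_rotate_reflect (a t y z : ℝ) :
    dirForm t (dirForm a y z) (Real.sin a * y - Real.cos a * z) = dirForm (a - t) y z := by
  simp only [dirForm, Real.cos_sub, Real.sin_sub]; ring

lemma dirForm_mono {t : ℝ} (ht : 0 ≤ Real.sin t) (y : ℝ) {z z' : ℝ} (h : z ≤ z') :
    dirForm t y z ≤ dirForm t y z' := by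
  unfold dirForm; gcongr

/-- The angle `2jπ/2^n` of a facet normal of the regular `2^n`-gon. -/
noncomputable def facetAngle (n j : ℕ) : ℝ := 2 * j * Real.pi / 2 ^ n

lemma facetAngle_two_pow {n i : ℕ} (hi : i < n) :
    facetAngle n (2 ^ (n - i - 1)) = Real.pi / 2 ^ i := by
  obtain ⟨d, rfl⟩ := Nat.exists_eq_add_of_lt hi
  have h : i + d + 1 - i - 1 = d := by omega
  rw [facetAngle, h]
  push_cast
  field_simp
  ring

lemma facetAngle_add (n i j : ℕ) :
    facetAngle n (i + j) = facetAngle n i + facetAngle n j := by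
  simp only [facetAngle]; push_cast; ring

lemma facetAngle_sub (n : ℕ) {i j : ℕ} (h : j ≤ i) :
    facetAngle n (i - j) = facetAngle n i - facetAngle n j := by
  simp only [facetAngle]; push_cast [h]; ring

lemma sin_facetAngle_nonneg {n j : ℕ} (h : j ≤ 2 ^ (n - 1)) (hn : 1 ≤ n) :
    0 ≤ Real.sin (facetAngle n j) := by
  obtain ⟨m, rfl⟩ := Nat.exists_eq_add_of_le' hn
  have h' : (j : ℝ) ≤ 2 ^ m := by exact_mod_cast h
  apply Real.sin_nonneg_of_nonneg_of_le_pi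
  · unfold facetAngle; positivity
  · rw [facetAngle, div_le_iff₀ (by positivity), pow_succ]
    nlinarith [Real.pi_pos]

/-- The facet inequalities of the regular `2^n`-gon with normals in the sector
`[0, 2π/2^i]`. -/
def SectorBound (n i : ℕ) (y z : ℝ) : Prop :=
  ∀ j ≤ 2 ^ (n - i), dirForm (facetAngle n j) y z ≤ 1

lemma two_pow_sub {n i : ℕ} (hi : i < n) : 2 ^ (n - i) = 2 * 2 ^ (n - i - 1) := by
  rw [← pow_succ']; congr 1; omega

lemma sectorBound_of_succ {n i : ℕ} (hi : i < n) {y z z' : ℝ}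
    (h₁ : -Real.sin (Real.pi / 2 ^ i) * y + Real.cos (Real.pi / 2 ^ i) * z ≤ z')
    (h₂ : Real.sin (Real.pi / 2 ^ i) * y - Real.cos (Real.pi / 2 ^ i) * z ≤ z')
    (h : SectorBound n (i + 1) (dirForm (Real.pi / 2 ^ i) y z) z') :
    SectorBound n i y z := by
  intro j hj
  rw [two_pow_sub hi] at hj
  rw [← facetAngle_two_pow hi] at h₁ h₂ h
  set m := 2 ^ (n - i - 1) with hm
  have hsin : ∀ l ≤ m, 0 ≤ Real.sin (facetAngle n l) := fun l hl =>
    sin_facetAngle_nonneg (hl.trans (Nat.pow_le_pow_right two_pos (by omega))) (by omega)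
  rcases le_total m j with hmj | hmj
  · have e : facetAngle n j = facetAngle n m + facetAngle n (j - m) := by
      rw [← facetAngle_add, Nat.add_sub_cancel' hmj]
    rw [e, ← dirForm_rotate]
    exact (dirForm_mono (hsin _ (by omega)) _ h₁).trans
      (h _ (by rw [← Nat.sub_sub]; omega))
  · have e : facetAngle n j = facetAngle n m - facetAngle n (m - j) := by
      rw [facetAngle_sub n hmj]; ring
    rw [e, ← dirForm_rotate_reflect]
    exact (dirForm_mono (hsin _ (by omega)) _ h₂).trans
      (h _ (by rw [← Nat.sub_sub]; omega))

lemma SectorBound.succ {n i : ℕ} (hi : i < n) {y z : ℝ} (h : SectorBound n i y z) :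
    SectorBound n (i + 1) (dirForm (Real.pi / 2 ^ i) y z)
      |-Real.sin (Real.pi / 2 ^ i) * y + Real.cos (Real.pi / 2 ^ i) * z| := by
  intro j hj
  rw [← Nat.sub_sub] at hj
  have hm := two_pow_sub hi
  rw [← facetAngle_two_pow hi]
  rcases abs_choice (-Real.sin (facetAngle n (2 ^ (n - i - 1))) * y
    + Real.cos (facetAngle n (2 ^ (n - i - 1))) * z) with e | e
  · rw [e, dirForm_rotate, ← facetAngle_add]
    exact h _ (by omega)
  · rw [e, show ∀ s c : ℝ, -(-s * y + c * z) = s * y - c * z by intros; ring,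
      dirForm_rotate_reflect, ← facetAngle_sub n hj]
    exact h _ (by omega)

lemma sectorBound_self_iff {n : ℕ} (hn : 1 ≤ n) {y z : ℝ} :
    SectorBound n n y z ↔ y ≤ 1 ∧ Real.cos (Real.pi / 2 ^ (n - 1)) * y
      + Real.sin (Real.pi / 2 ^ (n - 1)) * z ≤ 1 := by
  have h0 : dirForm (facetAngle n 0) y z = y := by simp [dirForm, facetAngle]
  have h1 : facetAngle n 1 = Real.pi / 2 ^ (n - 1) := by
    rw [← facetAngle_two_pow (show n - 1 < n by omega),
      show n - (n - 1) - 1 = 0 by omega, pow_zero]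
  constructor
  · intro h
    refine ⟨h0 ▸ h 0 (by simp), ?_⟩
    have := h 1 (by simp)
    rwa [h1] at this
  · rintro ⟨hy, hz⟩ j hj
    have hj' : j ≤ 1 := by simpa using hj
    interval_cases j
    · rwa [h0]
    · rwa [h1]

/-- The sequence of points obtained by successively rotating by `-π/2^i` and reflecting
into the upper half-plane. -/
noncomputable def foldSeq (x : Fin 2 → ℝ) : ℕ → ℝ × ℝ
  | 0 => (x 0, x 1)
  | i + 1 => (dirForm (Real.pi / 2 ^ i) (foldSeq x i).1 (foldSeq x i).2,
      |-Real.sin (Real.pi / 2 ^ i) * (foldSeq x i).1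
        + Real.cos (Real.pi / 2 ^ i) * (foldSeq x i).2|)

lemma sectorBound_foldSeq {n : ℕ} {x : Fin 2 → ℝ} (h : SectorBound n 0 (x 0) (x 1)) :
    ∀ i ≤ n, SectorBound n i (foldSeq x i).1 (foldSeq x i).2
  | 0, _ => h
  | i + 1, hi => (sectorBound_foldSeq h i (by omega)).succ (by omega)

lemma mem_proj_Pempty_iff {n : ℕ} (hn : 1 ≤ n) (x : Fin 2 → ℝ) :
    x ∈ proj2 '' Pempty n ↔ SectorBound n 0 (x 0) (x 1) := by
  constructor
  · rintro ⟨p, ⟨hstep, hlast⟩, rfl⟩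
    have key : ∀ i : Fin (n + 1), SectorBound n i (p.1 i) (p.2 i) := by
      intro i
      induction i using Fin.reverseInduction with
      | last => simpa using (sectorBound_self_iff hn).2 hlast
      | cast i ih =>
        obtain ⟨h, h₁, h₂⟩ := hstep i
        rw [h] at ih
        exact sectorBound_of_succ i.2 h₁ h₂ ih
    exact key 0
  · intro h
    refine ⟨(fun i => (foldSeq x i).1, fun i => (foldSeq x i).2), ⟨fun i => ⟨rfl, ?_, ?_⟩, ?_⟩, ?_⟩
    · exact le_abs_self _
    · refine le_trans (le_of_eq ?_) (neg_le_abs _)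
      simp only [Fin.val_castSucc]
      ring
    · exact (sectorBound_self_iff hn).1 (sectorBound_foldSeq h n le_rfl)
    · ext i
      fin_cases i <;> simp [proj2, foldSeq]

lemma cos_pi_div_two_pow_pos {n : ℕ} (hn : 2 ≤ n) : 0 < Real.cos (Real.pi / 2 ^ n) := by
  have h : (2 : ℝ) ^ 2 ≤ 2 ^ n := pow_le_pow_right₀ (by norm_num) hn
  apply Real.cos_pos_of_mem_Ioo
  constructor
  · have : 0 < Real.pi / 2 ^ n := by positivity
    linarith [Real.pi_pos]
  · exact div_lt_div_of_pos_left Real.pi_pos two_pos (by linarith)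

lemma dirForm_vtx (n ℓ j : ℕ) : dirForm (facetAngle n j) (vtx n ℓ 0) (vtx n ℓ 1) =
    Real.cos ((2 * ((ℓ : ℝ) - j) + 1) * (Real.pi / 2 ^ n)) / Real.cos (Real.pi / 2 ^ n) := by
  have e : (2 * ((ℓ : ℝ) - j) + 1) * (Real.pi / 2 ^ n)
      = (2 * ℓ + 1) * Real.pi / 2 ^ n - facetAngle n j := by
    simp only [facetAngle]; ring
  rw [e, Real.cos_sub]
  simp [dirForm, vtx]
  ring

lemma cos_odd_mul_le {α : ℝ} (hα : 0 ≤ α) {k s : ℤ} (hk : k * α = Real.pi)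
    (h₁ : -k ≤ s) (h₂ : s < k) : Real.cos ((2 * s + 1) * α) ≤ Real.cos α := by
  have e : Real.cos α - Real.cos ((2 * s + 1) * α)
      = 2 * (Real.sin ((s + 1) * α) * Real.sin (s * α)) := by
    rw [Real.cos_sub_cos, show (α + (2 * s + 1) * α) / 2 = (s + 1) * α by ring,
      show (α - (2 * s + 1) * α) / 2 = -(s * α) by ring, Real.sin_neg]
    ring
  have h₁' : -(k : ℝ) ≤ s := by exact_mod_cast h₁
  have h₂' : (s : ℝ) + 1 ≤ k := by exact_mod_cast h₂
  suffices 0 ≤ Real.sin ((s + 1) * α) * Real.sin (s * α) by linarith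
  rcases le_or_gt 0 s with hs | hs
  · have hs' : (0 : ℝ) ≤ s := by exact_mod_cast hs
    apply mul_nonneg <;> apply Real.sin_nonneg_of_nonneg_of_le_pi
    · positivity
    · nlinarith
    · positivity
    · nlinarith
  · have hs' : (s : ℝ) + 1 ≤ 0 := by exact_mod_cast hs
    apply mul_nonneg_of_nonpos_of_nonpos <;> apply Real.sin_nonpos_of_nonpos_of_neg_pi_le
    all_goals nlinarith

lemma sectorBound_vtx {n : ℕ} (hn : 2 ≤ n) {ℓ : ℕ} (hℓ : ℓ < 2 ^ n) :
    SectorBound n 0 (vtx n ℓ 0) (vtx n ℓ 1) := by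
  intro j hj
  rw [Nat.sub_zero] at hj
  rw [dirForm_vtx, div_le_one (cos_pi_div_two_pow_pos hn)]
  have hj' : (j : ℤ) ≤ 2 ^ n := by exact_mod_cast hj
  have hℓ' : (ℓ : ℤ) < 2 ^ n := by exact_mod_cast hℓ
  have := cos_odd_mul_le (α := Real.pi / 2 ^ n) (k := 2 ^ n) (s := (ℓ : ℤ) - j)
    (by positivity) (by push_cast; field_simp) (by omega) (by omega)
  simpa using this

lemma convex_sectorBound (n i : ℕ) : Convex ℝ {x : Fin 2 → ℝ | SectorBound n i (x 0) (x 1)} := by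
  intro x hx y hy a b ha hb hab j hj
  have h₁ := mul_le_mul_of_nonneg_left (hx j hj) ha
  have h₂ := mul_le_mul_of_nonneg_left (hy j hj) hb
  simp only [dirForm, Pi.add_apply, Pi.smul_apply, smul_eq_mul] at *
  linarith

lemma exists_polar (p q : ℝ) : ∃ r φ : ℝ, 0 ≤ r ∧ 0 ≤ φ ∧ φ < 2 * Real.pi ∧
    p = r * Real.cos φ ∧ q = r * Real.sin φ := by
  have hc := Complex.norm_mul_cos_arg ⟨p, q⟩
  have hs := Complex.norm_mul_sin_arg ⟨p, q⟩
  have h₁ := Complex.neg_pi_lt_arg ⟨p, q⟩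
  have h₂ := Complex.arg_le_pi ⟨p, q⟩
  rcases le_or_gt 0 (Complex.arg ⟨p, q⟩) with h | h
  · exact ⟨_, _, norm_nonneg _, h, by linarith [Real.pi_pos], hc.symm, hs.symm⟩
  · refine ⟨‖(⟨p, q⟩ : ℂ)‖, Complex.arg ⟨p, q⟩ + 2 * Real.pi, norm_nonneg _, by linarith,
      by linarith, ?_, ?_⟩
    · rw [Real.cos_add_two_pi, hc]
    · rw [Real.sin_add_two_pi, hs]

/-- Every vector lies in the cone spanned by two consecutive facet normals. -/
lemma exists_facet_cone {n : ℕ} (hn : 2 ≤ n) (p q : ℝ) :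
    ∃ ℓ < 2 ^ n, ∃ a b : ℝ, 0 ≤ a ∧ 0 ≤ b ∧ ∀ y z : ℝ,
      p * y + q * z = a * dirForm (facetAngle n ℓ) y z
        + b * dirForm (facetAngle n (ℓ + 1)) y z := by
  obtain ⟨r, φ, hr, hφ, hφ', rfl, rfl⟩ := exists_polar p q
  set δ : ℝ := 2 * Real.pi / 2 ^ n with hδ
  have hδ0 : 0 < δ := by positivity
  have hδk : 2 ^ n * δ = 2 * Real.pi := by rw [hδ]; field_simp
  have hδπ : δ < Real.pi := by
    have h : (2 : ℝ) ^ 2 ≤ 2 ^ n := pow_le_pow_right₀ (by norm_num) hn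
    nlinarith
  have hs : 0 < Real.sin δ := Real.sin_pos_of_pos_of_lt_pi hδ0 hδπ
  have hl : (⌊φ / δ⌋₊ : ℝ) * δ ≤ φ := by
    rw [← le_div_iff₀ hδ0]; exact Nat.floor_le (by positivity)
  have hu : φ < (⌊φ / δ⌋₊ + 1 : ℝ) * δ := by
    rw [← div_lt_iff₀ hδ0]; exact Nat.lt_floor_add_one _
  generalize ⌊φ / δ⌋₊ = ℓ at hl hu
  have e₀ : facetAngle n ℓ = ℓ * δ := by rw [facetAngle, hδ]; ring
  have e₁ : facetAngle n (ℓ + 1) = ℓ * δ + δ := by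
    rw [facetAngle, hδ]; push_cast; ring
  refine ⟨ℓ, ?_, r * Real.sin (ℓ * δ + δ - φ) / Real.sin δ,
    r * Real.sin (φ - ℓ * δ) / Real.sin δ, ?_, ?_, ?_⟩
  · have : (ℓ : ℝ) < 2 ^ n := by
      by_contra! h
      nlinarith
    exact_mod_cast this
  · exact div_nonneg (mul_nonneg hr (Real.sin_nonneg_of_nonneg_of_le_pi (by linarith)
      (by linarith))) hs.le
  · exact div_nonneg (mul_nonneg hr (Real.sin_nonneg_of_nonneg_of_le_pi (by linarith)
      (by linarith))) hs.le
  · intro y z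
    rw [e₀, e₁]
    obtain ⟨ψ, hψ⟩ : ∃ ψ, φ = ℓ * δ + ψ := ⟨φ - ℓ * δ, by ring⟩
    rw [hψ, show (ℓ : ℝ) * δ + δ - (ℓ * δ + ψ) = δ - ψ by ring, add_sub_cancel_left]
    simp only [dirForm, Real.sin_sub, Real.cos_add, Real.sin_add]
    field_simp
    ring

lemma mem_Qgon_of_sectorBound {n : ℕ} (hn : 2 ≤ n) {x : Fin 2 → ℝ}
    (hx : SectorBound n 0 (x 0) (x 1)) : x ∈ Qgon n := by
  by_contra hxQ
  have hfin : {x | ∃ ℓ < 2 ^ n, x = vtx n ℓ}.Finite :=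
    ((Set.finite_lt_nat (2 ^ n)).image (vtx n)).subset
      (by rintro _ ⟨ℓ, hℓ, rfl⟩; exact ⟨ℓ, hℓ, rfl⟩)
  obtain ⟨f, u, hf, hfx⟩ := geometric_hahn_banach_closed_point
    (convex_convexHull ℝ _) (hfin.isClosed_convexHull ℝ) hxQ
  have hfe : ∀ w : Fin 2 → ℝ, f w = f (Pi.single 0 1) * w 0 + f (Pi.single 1 1) * w 1 := by
    intro w
    have hw : w = w 0 • Pi.single 0 1 + w 1 • Pi.single 1 1 := by
      ext i; fin_cases i <;> simp
    conv_lhs => rw [hw]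
    simp [mul_comm]
  obtain ⟨ℓ, hℓ, a, b, ha, hb, hab⟩ :=
    exists_facet_cone hn (f (Pi.single 0 1)) (f (Pi.single 1 1))
  have hv := hf _ (subset_convexHull ℝ _ ⟨ℓ, hℓ, rfl⟩)
  have hc := (cos_pi_div_two_pow_pos hn).ne'
  have v₀ : dirForm (facetAngle n ℓ) (vtx n ℓ 0) (vtx n ℓ 1) = 1 := by
    rw [dirForm_vtx, sub_self, mul_zero, zero_add, one_mul, div_self hc]
  have v₁ : dirForm (facetAngle n (ℓ + 1)) (vtx n ℓ 0) (vtx n ℓ 1) = 1 := by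
    rw [dirForm_vtx, Nat.cast_succ,
      show (2 * ((ℓ : ℝ) - (ℓ + 1)) + 1) * (Real.pi / 2 ^ n) = -(Real.pi / 2 ^ n) by ring,
      Real.cos_neg, div_self hc]
  rw [hfe, hab, v₀, v₁] at hv
  rw [hfe, hab] at hfx
  have h₀ := mul_le_mul_of_nonneg_left (hx ℓ hℓ.le) ha
  have h₁ := mul_le_mul_of_nonneg_left (hx (ℓ + 1) hℓ) hb
  linarith

lemma mem_Qgon_iff {n : ℕ} (hn : 2 ≤ n) (x : Fin 2 → ℝ) :
    x ∈ Qgon n ↔ SectorBound n 0 (x 0) (x 1) := by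
  refine ⟨fun h => ?_, mem_Qgon_of_sectorBound hn⟩
  refine convexHull_min ?_ (convex_sectorBound n 0) h
  rintro _ ⟨ℓ, hℓ, rfl⟩
  exact sectorBound_vtx hn hℓ

/-- The projection of `P^∅_n` to the coordinates `(y_1, z_1)` is the regular
`2^n`-gon `Q_{2^n}`. -/
theorem proj_Pempty_eq_Qgon (n : ℕ) (hn : 2 ≤ n) :
    proj2 '' Pempty n = Qgon n := by
  ext x
  rw [mem_proj_Pempty_iff (by omega), mem_Qgon_iff hn]
end

section
/- Let n ≥ 2 and k = 2^n. For every (y,z) ∈ P^∅_n and every ℓ ∈ {0,…,k−1}, the inequality ⟨w_ℓ, (y_1, z_1)⟩ ≤ 1 holds, where ⟨·,·⟩ is the standard inner product on ℝ². -/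
open Real MeasureTheory Matrix

/-- Folding step: rotating by `-φ` and reflecting into the upper half-plane (up to increasing the
second coordinate) turns the functional in direction `α` into the one in direction `|α - φ|`,
without decreasing its value. -/
theorem cos_mul_add_sin_mul_le_of_fold {y z y' z' φ α : ℝ}
    (hy : y' = cos φ * y + sin φ * z)
    (hz₁ : -sin φ * y + cos φ * z ≤ z') (hz₂ : sin φ * y - cos φ * z ≤ z')
    (hα : |α - φ| ≤ π) :
    cos α * y + sin α * z ≤ cos |α - φ| * y' + sin |α - φ| * z' := by
  have rotate : cos α * y + sin α * z =
      cos (α - φ) * y' + sin (α - φ) * (-sin φ * y + cos φ * z) := by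
    rw [hy, cos_sub, sin_sub]
    linear_combination (-cos α * y - sin α * z) * sin_sq_add_cos_sq φ
  have hs : 0 ≤ sin |α - φ| := sin_nonneg_of_nonneg_of_le_pi (abs_nonneg _) hα
  rw [rotate, cos_abs]
  rcases abs_cases (α - φ) with ⟨h, -⟩ | ⟨h, -⟩
  · rw [h] at hs ⊢
    linarith [mul_le_mul_of_nonneg_left hz₁ hs]
  · rw [h, sin_neg] at hs ⊢
    linarith [mul_le_mul_of_nonneg_left hz₂ hs]

/-- At the `i`-th stage, `P^∅_n` satisfies the facet inequalities of the regular `2^n`-gon in the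
directions with angle a multiple of `2π / 2^n` in `[0, 2π / 2^i]`. -/
theorem cos_mul_add_sin_mul_le_one_of_mem_Pempty {n : ℕ}
    {p : (Fin (n + 1) → ℝ) × (Fin (n + 1) → ℝ)} (hp : p ∈ Pempty n) (i : Fin (n + 1)) :
    ∀ m : ℕ, m ≤ 2 ^ (n - (i : ℕ)) →
      cos (m * (π / 2 ^ (n - 1))) * p.1 i + sin (m * (π / 2 ^ (n - 1))) * p.2 i ≤ 1 := by
  obtain ⟨hstep, hlast₀, hlast₁⟩ := hp
  induction i using Fin.reverseInduction with
  | last =>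
    intro m hm
    have hm1 : m ≤ 1 := by simpa using hm
    interval_cases m
    · simpa using hlast₀
    · simpa using hlast₁
  | cast i ih =>
    intro m hm
    obtain ⟨hy, hz₁, hz₂⟩ := hstep i
    have hi := i.isLt
    obtain ⟨d, hd⟩ : ∃ d, n - 1 = i + d := ⟨n - 1 - i, by omega⟩
    have hφ : π / 2 ^ (i : ℕ) = ((2 : ℤ) ^ d : ℤ) * (π / 2 ^ (n - 1)) := by
      rw [hd, pow_add]
      push_cast
      field_simp
    have hfold : |m * (π / 2 ^ (n - 1)) - π / 2 ^ (i : ℕ)| =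
        ((m - 2 ^ d : ℤ).natAbs : ℝ) * (π / 2 ^ (n - 1)) := by
      rw [hφ, ← Int.cast_natCast (m - 2 ^ d : ℤ).natAbs, Int.natCast_natAbs, Int.cast_abs,
        ← abs_of_nonneg (show 0 ≤ π / 2 ^ (n - 1) by positivity), ← abs_mul,
        abs_of_nonneg (show 0 ≤ π / 2 ^ (n - 1) by positivity)]
      push_cast
      ring_nf
    have hbound : (m - 2 ^ d : ℤ).natAbs ≤ 2 ^ d := by
      rw [Fin.val_castSucc, show n - (i : ℕ) = d + 1 by omega, pow_succ] at hm
      zify at hm ⊢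
      exact abs_le.2 ⟨by linarith, by linarith⟩
    have hα : |m * (π / 2 ^ (n - 1)) - π / 2 ^ (i : ℕ)| ≤ π := calc
      _ = ((m - 2 ^ d : ℤ).natAbs : ℝ) * (π / 2 ^ (n - 1)) := hfold
      _ ≤ 2 ^ d * (π / 2 ^ (n - 1)) := by
        gcongr
        exact_mod_cast hbound
      _ = π / 2 ^ (i : ℕ) := by rw [hφ]; push_cast; rfl
      _ ≤ π := div_le_self pi_pos.le (one_le_pow₀ one_le_two)
    refine (cos_mul_add_sin_mul_le_of_fold hy hz₁ hz₂ hα).trans ?_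
    rw [hfold]
    refine ih _ ?_
    rwa [Fin.val_succ, show n - ((i : ℕ) + 1) = d by omega]

/-- For every `(y,z) ∈ P^∅_n` and every `ℓ ∈ {0,…,2^n − 1}`, we have `⟨w_ℓ, (y_1,z_1)⟩ ≤ 1`. -/
theorem wpt_dot_proj_le_one (n : ℕ) (hn : 2 ≤ n)
    (p : (Fin (n + 1) → ℝ) × (Fin (n + 1) → ℝ)) (hp : p ∈ Pempty n)
    (ℓ : ℕ) (hℓ : ℓ < 2 ^ n) :
    wpt n ℓ ⬝ᵥ proj2 p ≤ 1 := by
  have hn0 : n ≠ 0 := by omega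
  have h := cos_mul_add_sin_mul_le_one_of_mem_Pempty hp 0 (ℓ + 1) (by simpa using hℓ)
  have hangle : (2 * ℓ + 2) * π / 2 ^ n = ((ℓ + 1 : ℕ) : ℝ) * (π / 2 ^ (n - 1)) := by
    obtain ⟨k, rfl⟩ := Nat.exists_eq_succ_of_ne_zero hn0
    rw [Nat.succ_sub_one, pow_succ]
    push_cast
    field_simp
  simpa [wpt, proj2, dotProduct, Fin.sum_univ_two, hangle] using h
end

section
/- Let n ≥ 2, k = 2^n, and let e ⊆ {1,…,n} be a two-element set. Then for every ℓ ∈ {0,…,k−1}, the edge midpoint w_ℓ belongs to P̄^e_n, the projection of P^e_n onto the coordinates (y_1,z_1). -/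
open Real MeasureTheory Matrix

/-- Consecutive integer multiples of `π / N` have sines of the same (weak) sign. -/
theorem sin_mul_sin_consecutive_nonneg (N : ℕ) (hN : 0 < N) (k : ℤ) :
    0 ≤ Real.sin ((k + 1) * (Real.pi / N)) * Real.sin (k * (Real.pi / N)) := by
  have hN' : (0 : ℝ) < N := by exact_mod_cast hN
  obtain ⟨q, r, hr0, hrN, hk⟩ : ∃ q r : ℤ, 0 ≤ r ∧ r < N ∧ k = r + q * N :=
    ⟨k / N, k % N, Int.emod_nonneg _ (by omega), Int.emod_lt_of_pos _ (by omega),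
      by rw [mul_comm]; exact (Int.emod_add_mul_ediv k N).symm⟩
  have hkR : (k : ℝ) = r + q * N := by exact_mod_cast hk
  have hr0' : (0 : ℝ) ≤ r := by exact_mod_cast hr0
  have hrN' : (r : ℝ) + 1 ≤ N := by exact_mod_cast hrN
  have e1 : (k + 1) * (Real.pi / N) = (r + 1) * (Real.pi / N) + q * Real.pi := by
    rw [hkR]; field_simp; ring
  have e2 : k * (Real.pi / N) = r * (Real.pi / N) + q * Real.pi := by
    rw [hkR]; field_simp
  have hmem : ∀ t : ℝ, 0 ≤ t → t ≤ N → 0 ≤ Real.sin (t * (Real.pi / N)) := by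
    intro t h0 h1
    apply Real.sin_nonneg_of_nonneg_of_le_pi
    · positivity
    · calc t * (Real.pi / N) ≤ N * (Real.pi / N) := by gcongr
        _ = Real.pi := by field_simp
  rw [e1, e2, Real.sin_add_int_mul_pi, Real.sin_add_int_mul_pi, mul_mul_mul_comm,
    ← mul_zpow]
  simpa using mul_nonneg (hmem (r + 1) (by positivity) hrN') (hmem r hr0' (by linarith))

/-- Points of the unit circle at even multiples of `π / N` satisfy the facet inequality whose
outer normal points in the direction `π / N`. -/
theorem cos_even_mul_facet_le (N : ℕ) (hN : 0 < N) (m : ℤ) :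
    Real.cos (Real.pi / N) * Real.cos (2 * m * (Real.pi / N))
      + Real.sin (Real.pi / N) * Real.sin (2 * m * (Real.pi / N)) ≤ Real.cos (Real.pi / N) := by
  have h := sin_mul_sin_consecutive_nonneg N hN (m - 1)
  push_cast at h
  rw [sub_add_cancel] at h
  have h2 := Real.cos_sub_cos (Real.pi / N - 2 * m * (Real.pi / N)) (Real.pi / N)
  rw [show (Real.pi / N - 2 * m * (Real.pi / N) + Real.pi / N) / 2
      = -((m - 1) * (Real.pi / N)) by ring,
    show (Real.pi / N - 2 * m * (Real.pi / N) - Real.pi / N) / 2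
      = -(m * (Real.pi / N)) by ring, Real.sin_neg, Real.sin_neg] at h2
  rw [← Real.cos_sub]
  linarith

/-- Rotating clockwise by `π / 2 ^ i` and reflecting into the upper half plane whenever `i` does
not satisfy `p`, tracked through the index `m` of the angle `2 m π / 2 ^ n`. -/
noncomputable def foldIndex (n : ℕ) (p : ℕ → Prop) (m : ℤ) : ℕ → ℤ
  | 0 => m
  | i + 1 =>
    open Classical in
    if p i ∨ 0 ≤ Real.sin (2 * ((foldIndex n p m i - 2 ^ (n - 1 - i) : ℤ) : ℝ) * (Real.pi / 2 ^ n))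
    then foldIndex n p m i - 2 ^ (n - 1 - i)
    else -(foldIndex n p m i - 2 ^ (n - 1 - i))

theorem two_mul_sub_two_pow_mul (n i : ℕ) (hi : i < n) (m : ℤ) :
    2 * ((m - 2 ^ (n - 1 - i) : ℤ) : ℝ) * (Real.pi / 2 ^ n)
      = 2 * m * (Real.pi / 2 ^ n) - Real.pi / 2 ^ i := by
  obtain ⟨d, rfl⟩ := Nat.exists_eq_add_of_lt hi
  rw [show i + d + 1 - 1 - i = d by omega]
  push_cast
  field_simp
  ring

/-- Every edge midpoint `w_ℓ` belongs to the projection of `P^e_n` onto `(y_1, z_1)`. -/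
theorem wpt_mem_proj_Pe (n : ℕ) (hn : 2 ≤ n)
    (e : Finset (Fin n)) (he : e.card = 2)
    (ℓ : ℕ) (hℓ : ℓ < 2 ^ n) :
    wpt n ℓ ∈ proj2 '' Pe n e := by
  set m := foldIndex n (fun i => ∃ h : i < n, (⟨i, h⟩ : Fin n) ∈ e) (ℓ + 1) with hm
  refine ⟨(fun i => Real.cos (2 * m i * (Real.pi / 2 ^ n)),
    fun i => Real.sin (2 * m i * (Real.pi / 2 ^ n))), ⟨fun i => ?_, ?_⟩, ?_⟩
  · have hang := two_mul_sub_two_pow_mul n i i.2 (m i)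
    have hcos : Real.cos (2 * ((m i - 2 ^ (n - 1 - i) : ℤ) : ℝ) * (Real.pi / 2 ^ n))
        = Real.cos (Real.pi / 2 ^ (i : ℕ)) * Real.cos (2 * m i * (Real.pi / 2 ^ n))
          + Real.sin (Real.pi / 2 ^ (i : ℕ)) * Real.sin (2 * m i * (Real.pi / 2 ^ n)) := by
      rw [hang, Real.cos_sub]; ring
    have hsin : Real.sin (2 * ((m i - 2 ^ (n - 1 - i) : ℤ) : ℝ) * (Real.pi / 2 ^ n))
        = -Real.sin (Real.pi / 2 ^ (i : ℕ)) * Real.cos (2 * m i * (Real.pi / 2 ^ n))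
          + Real.cos (Real.pi / 2 ^ (i : ℕ)) * Real.sin (2 * m i * (Real.pi / 2 ^ n)) := by
      rw [hang, Real.sin_sub]; ring
    have hsucc : m (i + 1) = if i ∈ e ∨
        0 ≤ Real.sin (2 * ((m i - 2 ^ (n - 1 - i) : ℤ) : ℝ) * (Real.pi / 2 ^ n))
        then m i - 2 ^ (n - 1 - i) else -(m i - 2 ^ (n - 1 - i)) := by
      simp [hm, foldIndex]
    have hneg : 2 * ((-(m i - 2 ^ (n - 1 - i)) : ℤ) : ℝ) * (Real.pi / 2 ^ n)
        = -(2 * ((m i - 2 ^ (n - 1 - i) : ℤ) : ℝ) * (Real.pi / 2 ^ n)) := by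
      rw [Int.cast_neg]; ring
    simp only [Fin.val_succ, Fin.val_castSucc]
    rw [hsucc]
    by_cases hi : i ∈ e
    · simp only [hi, true_or, if_true]
      exact ⟨hcos, hsin⟩
    · simp only [hi, false_or, if_false]
      split_ifs with h0
      · exact ⟨hcos, hsin.ge, by linarith⟩
      · rw [hneg, Real.cos_neg, Real.sin_neg]
        exact ⟨hcos, by linarith, by linarith⟩
  · simpa using cos_even_mul_facet_le (2 ^ n) (by positivity) (m n)
  · have h0 : 2 * (m 0 : ℝ) * (Real.pi / 2 ^ n) = (2 * ℓ + 2) * Real.pi / 2 ^ n := by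
      simp only [hm, foldIndex]
      push_cast
      ring
    simp [proj2, wpt, h0]
end

section
/- Let n ≥ 2, k = 2^n, let e ⊆ {1,…,n} be a two-element set, and let ℓ ∈ {0,…,k−1} be such that e ⊆ S_ℓ. Then ⟨v_ℓ, p⟩ ≤ 1 for every p ∈ P̄^e_n, and this bound is attained at the points w_{ℓ−1} and w_ℓ (indices mod k): both lie in P̄^e_n and satisfy ⟨v_ℓ, w_{ℓ−1}⟩ = ⟨v_ℓ, w_ℓ⟩ = 1. -/
open Real MeasureTheory Matrix

/-- The point of the unit circle at angle `θ`. -/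
noncomputable def circlePt (θ : ℝ) : Fin 2 → ℝ := ![Real.cos θ, Real.sin θ]

/-- One step of `chainAux`, in coordinates. -/
lemma chain_step (c : Fin 2) (j : ℕ) (x : Fin 2 → ℝ) :
    (reflM ^ (c : ℕ)) *ᵥ (rotM j *ᵥ x) =
      ![Real.cos (Real.pi / 2 ^ j) * x 0 + Real.sin (Real.pi / 2 ^ j) * x 1,
        (-1) ^ (c : ℕ) *
          (-Real.sin (Real.pi / 2 ^ j) * x 0 + Real.cos (Real.pi / 2 ^ j) * x 1)] := by
  fin_cases c <;> ext i <;> fin_cases i <;>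
    simp [reflM, rotM, Matrix.mulVec, dotProduct, Fin.sum_univ_two]

lemma chainAux_succ {n : ℕ} (b : Fin n → Fin 2) (x : Fin 2 → ℝ) {i : ℕ} (h : i < n) :
    chainAux n b x (i + 1) =
      (reflM ^ ((b ⟨i, h⟩ : Fin 2) : ℕ)) *ᵥ (rotM i *ᵥ chainAux n b x i) := by
  simp [chainAux, h]

lemma neg_one_pow_fin_two (c : Fin 2) :
    ((-1 : ℝ) ^ (c : ℕ) = 1) ∨ ((-1 : ℝ) ^ (c : ℕ) = -1) := by
  fin_cases c <;> simp

lemma chain_step_circlePt (c : Fin 2) (j : ℕ) (θ : ℝ) :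
    (reflM ^ (c : ℕ)) *ᵥ (rotM j *ᵥ circlePt θ) =
      circlePt ((-1) ^ (c : ℕ) * (θ - Real.pi / 2 ^ j)) := by
  rw [chain_step]
  rcases neg_one_pow_fin_two c with h | h <;> rw [h] <;> ext i <;> fin_cases i <;>
    simp [circlePt, Real.cos_sub, Real.sin_sub] <;> ring

/-- A chain step is inverted on polar coordinates by reflecting and rotating back. -/
lemma eq_of_chain_step_eq {c : Fin 2} {j : ℕ} {x : Fin 2 → ℝ} {r θ : ℝ}
    (h : (reflM ^ (c : ℕ)) *ᵥ (rotM j *ᵥ x) = r • circlePt θ) :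
    x = r • circlePt (Real.pi / 2 ^ j + (-1) ^ (c : ℕ) * θ) := by
  rw [chain_step] at h
  have h0 := congrFun h 0
  have h1 := congrFun h 1
  have hsc := Real.sin_sq_add_cos_sq (Real.pi / 2 ^ j)
  simp only [circlePt, Pi.smul_apply, smul_eq_mul, cons_val_zero, cons_val_one] at h0 h1
  generalize hα : Real.pi / 2 ^ j = α at *
  rcases neg_one_pow_fin_two c with hc | hc <;> rw [hc] at h1 ⊢ <;> ext i <;> fin_cases i <;>
    simp [circlePt, Real.cos_add, Real.sin_add]
  · linear_combination Real.cos α * h0 - Real.sin α * h1 - x 0 * hsc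
  · linear_combination Real.sin α * h0 + Real.cos α * h1 - x 1 * hsc
  · linear_combination Real.cos α * h0 + Real.sin α * h1 - x 0 * hsc
  · linear_combination Real.sin α * h0 - Real.cos α * h1 - x 1 * hsc

lemma vtx_eq_smul_circlePt (n ℓ : ℕ) :
    vtx n ℓ = (Real.cos (Real.pi / 2 ^ n))⁻¹ • circlePt ((2 * ℓ + 1) * Real.pi / 2 ^ n) := rfl

/-- If the chain ends at `v_0`, its `i`-th point has an angle in
`[π / 2 ^ n, 2 π / 2 ^ i - π / 2 ^ n]`. -/
lemma exists_angle_chainAux {n : ℕ} {b : Fin n → Fin 2} {x : Fin 2 → ℝ}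
    (hb : chainAux n b x n = vtx n 0) {i : ℕ} (hi : i ≤ n) :
    ∃ θ : ℝ, Real.pi / 2 ^ n ≤ θ ∧ θ ≤ 2 * (Real.pi / 2 ^ i) - Real.pi / 2 ^ n ∧
      chainAux n b x i = (Real.cos (Real.pi / 2 ^ n))⁻¹ • circlePt θ := by
  induction hi using Nat.decreasingInduction with
  | self =>
    refine ⟨Real.pi / 2 ^ n, le_rfl, by linarith, ?_⟩
    rw [hb, vtx_eq_smul_circlePt]
    simp
  | of_succ i hi ih =>
    obtain ⟨θ, h1, h2, h3⟩ := ih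
    rw [chainAux_succ b x hi] at h3
    have hpow : 2 * (Real.pi / 2 ^ (i + 1)) = Real.pi / 2 ^ i := by
      rw [pow_succ]
      field_simp
    rw [hpow] at h2
    have hδ : 0 < Real.pi / 2 ^ n := by positivity
    refine ⟨_, ?_, ?_, eq_of_chain_step_eq h3⟩ <;>
      rcases neg_one_pow_fin_two (b ⟨i, hi⟩) with hc | hc <;> rw [hc] <;> linarith

lemma two_mul_pi_div_two_pow_succ_le (i : ℕ) : 2 * (Real.pi / 2 ^ (i + 1)) ≤ Real.pi := by
  have h : 2 * (Real.pi / 2 ^ (i + 1)) = Real.pi / 2 ^ i := by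
    rw [pow_succ]
    field_simp
  rw [h]
  exact div_le_self Real.pi_pos.le (one_le_pow₀ (by norm_num))

/-- Chains started at angles differing by `± δ` keep that property. -/
lemma exists_sign_chainAux {n : ℕ} (b : Fin n → Fin 2) {r α δ s : ℝ} (hr : r ≠ 0)
    (hs : s = 1 ∨ s = -1) {i : ℕ} (hi : i ≤ n) :
    ∃ t : ℝ, (t = 1 ∨ t = -1) ∧ ∀ θ, chainAux n b (r • circlePt α) i = r • circlePt θ →
      chainAux n b (circlePt (α + s * δ)) i = circlePt (θ + t * δ) := by
  induction i with
  | zero =>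
    refine ⟨s, hs, fun θ h => ?_⟩
    have h' : circlePt α = circlePt θ := smul_right_injective _ hr h
    have h0 : Real.cos α = Real.cos θ := congrFun h' 0
    have h1 : Real.sin α = Real.sin θ := congrFun h' 1
    change circlePt (α + s * δ) = circlePt (θ + s * δ)
    simp only [circlePt, Real.cos_add, Real.sin_add, h0, h1]
  | succ i ih =>
    obtain ⟨t, ht, H⟩ := ih (by omega)
    have hc := neg_one_pow_fin_two (b ⟨i, hi⟩)
    refine ⟨(-1) ^ (b ⟨i, hi⟩ : ℕ) * t, ?_, fun θ h => ?_⟩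
    · rcases hc with hc | hc <;> rcases ht with rfl | rfl <;> simp [hc]
    · rw [chainAux_succ b _ hi] at h ⊢
      rw [H _ (eq_of_chain_step_eq h), chain_step_circlePt]
      congr 1
      rcases hc with hc | hc <;> rw [hc] <;> ring

/-- The inner product with the dual chain does not decrease along `P^e_n`. -/
lemma vtx_dot_proj2_le_one {n : ℕ} (hn : 2 ≤ n) {e : Finset (Fin n)} {x : Fin 2 → ℝ}
    {b : Fin n → Fin 2} (hb : chainAux n b x n = vtx n 0) (hS : ∀ i ∈ e, b i = 0)
    {p : (Fin (n + 1) → ℝ) × (Fin (n + 1) → ℝ)} (hp : p ∈ Pe n e) :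
    x ⬝ᵥ proj2 p ≤ 1 := by
  obtain ⟨hstep, hlast⟩ := hp
  have hcos := cos_pi_div_two_pow_pos hn
  have key : ∀ i : ℕ, ∀ hi : i ≤ n, x ⬝ᵥ proj2 p ≤
      chainAux n b x i 0 * p.1 ⟨i, by omega⟩ + chainAux n b x i 1 * p.2 ⟨i, by omega⟩ := by
    intro i
    induction i with
    | zero =>
      intro _
      simp [dotProduct, Fin.sum_univ_two, proj2, chainAux]
    | succ i ih =>
      intro hi
      refine (ih (by omega)).trans ?_
      obtain ⟨θ, h1, h2, h3⟩ := exists_angle_chainAux hb hi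
      have hnn : 0 ≤ chainAux n b x (i + 1) 1 := by
        rw [h3]
        have hδ : 0 < Real.pi / 2 ^ n := by positivity
        have := two_mul_pi_div_two_pow_succ_le i
        have hsin : 0 ≤ Real.sin θ :=
          Real.sin_nonneg_of_nonneg_of_le_pi (by linarith) (by linarith)
        simp only [circlePt, Pi.smul_apply, smul_eq_mul, cons_val_one, cons_val_zero]
        positivity
      obtain ⟨hy, hz⟩ := hstep ⟨i, hi⟩
      have hb0 := hS ⟨i, hi⟩
      rw [chainAux_succ b x hi, chain_step] at hnn ⊢
      simp only [cons_val_one, cons_val_zero, Fin.succ_mk, Fin.castSucc_mk] at hnn hy hz ⊢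
      rw [hy]
      have hsc := Real.sin_sq_add_cos_sq (Real.pi / 2 ^ i)
      generalize Real.cos (Real.pi / 2 ^ i) = C at *
      generalize Real.sin (Real.pi / 2 ^ i) = S at *
      generalize chainAux n b x i 0 = u at *
      generalize chainAux n b x i 1 = v at *
      generalize p.1 ⟨i, _⟩ = y at *
      generalize p.2 ⟨i, _⟩ = z at *
      generalize p.2 ⟨i + 1, _⟩ = z' at *
      have hdot : u * y + v * z =
          (C * u + S * v) * (C * y + S * z) + (-S * u + C * v) * (-S * y + C * z) := by
        linear_combination (-(u * y + v * z)) * hsc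
      rw [hdot]
      refine add_le_add le_rfl ?_
      split_ifs at hz with hie
      · rw [hb0 hie, hz]
        simp
      · obtain ⟨hz1, hz2⟩ := hz
        rcases neg_one_pow_fin_two (b ⟨i, hi⟩) with hc | hc <;> rw [hc] at hnn ⊢
        · have := mul_le_mul_of_nonneg_left hz1 hnn
          linarith
        · have := mul_le_mul_of_nonneg_left hz2 hnn
          linarith
  refine (key n le_rfl).trans ?_
  rw [hb]
  change Real.cos (Real.pi / 2 ^ n) * p.1 ⟨n, _⟩ + Real.sin (Real.pi / 2 ^ n) * p.2 ⟨n, _⟩ ≤ _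
    at hlast
  simp only [vtx, Pi.smul_apply, smul_eq_mul, cons_val_one, cons_val_zero, Nat.cast_zero,
    mul_zero, zero_add, one_mul]
  rw [mul_assoc, mul_assoc, ← mul_add, inv_mul_le_iff₀ hcos]
  linarith

/-- A point at angle `± π / 2 ^ n` from `v_ℓ` lies in the projection of `P^e_n`. -/
lemma circlePt_mem_proj2_image_Pe {n : ℕ} (hn : 2 ≤ n) {e : Finset (Fin n)} {ℓ : ℕ}
    {b : Fin n → Fin 2} (hb : chainAux n b (vtx n ℓ) n = vtx n 0) (hS : ∀ i ∈ e, b i = 0)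
    {s : ℝ} (hs : s = 1 ∨ s = -1) :
    circlePt ((2 * ℓ + 1) * Real.pi / 2 ^ n + s * (Real.pi / 2 ^ n)) ∈ proj2 '' Pe n e := by
  have hcos := cos_pi_div_two_pow_pos hn
  have hδ : 0 < Real.pi / 2 ^ n := by positivity
  set w := circlePt ((2 * ℓ + 1) * Real.pi / 2 ^ n + s * (Real.pi / 2 ^ n)) with hw
  have hpolar : ∀ i ≤ n, ∃ t : ℝ, (t = 1 ∨ t = -1) ∧
      ∀ θ, chainAux n b (vtx n ℓ) i = (Real.cos (Real.pi / 2 ^ n))⁻¹ • circlePt θ →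
        chainAux n b w i = circlePt (θ + t * (Real.pi / 2 ^ n)) :=
    fun i hi => exists_sign_chainAux b (inv_ne_zero hcos.ne') hs hi
  refine ⟨(fun i => chainAux n b w i 0, fun i => chainAux n b w i 1), ⟨fun i => ?_, ?_⟩, ?_⟩
  · obtain ⟨i, hi⟩ := i
    obtain ⟨t, ht, H⟩ := hpolar (i + 1) hi
    obtain ⟨θ, h1, h2, h3⟩ := exists_angle_chainAux hb (i := i + 1) hi
    have hnn : 0 ≤ chainAux n b w (i + 1) 1 := by
      rw [H θ h3]
      have := two_mul_pi_div_two_pow_succ_le i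
      apply Real.sin_nonneg_of_nonneg_of_le_pi <;> rcases ht with rfl | rfl <;> linarith
    have hb0 := hS ⟨i, hi⟩
    simp only [Fin.val_succ, Fin.val_castSucc]
    rw [chainAux_succ b w hi, chain_step] at hnn ⊢
    simp only [cons_val_one, cons_val_zero] at hnn ⊢
    refine ⟨trivial, ?_⟩
    split_ifs with hie
    · rw [hb0 hie]
      simp
    · rcases neg_one_pow_fin_two (b ⟨i, hi⟩) with hc | hc <;> rw [hc] at hnn ⊢ <;>
        constructor <;> linarith
  · obtain ⟨t, ht, H⟩ := hpolar n le_rfl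
    have hend := H (Real.pi / 2 ^ n) (by rw [hb, vtx_eq_smul_circlePt]; simp)
    simp only [Fin.val_last, hend, circlePt, cons_val_one, cons_val_zero]
    rw [← Real.cos_sub]
    apply le_of_eq
    rcases ht with rfl | rfl
    · rw [← Real.cos_neg]
      congr 1
      ring
    · congr 1
      ring
  · ext j
    fin_cases j <;> simp [proj2, chainAux]

lemma vtx_dot_circlePt {n : ℕ} (hn : 2 ≤ n) (ℓ : ℕ) {s : ℝ} (hs : s = 1 ∨ s = -1) :
    vtx n ℓ ⬝ᵥ circlePt ((2 * ℓ + 1) * Real.pi / 2 ^ n + s * (Real.pi / 2 ^ n)) = 1 := by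
  have hcos := cos_pi_div_two_pow_pos hn
  rw [vtx_eq_smul_circlePt, smul_dotProduct, smul_eq_mul, inv_mul_eq_one₀ hcos.ne']
  generalize (2 * ℓ + 1) * Real.pi / 2 ^ n = α
  simp only [dotProduct, Fin.sum_univ_two, circlePt, cons_val_one, cons_val_zero]
  rw [← Real.cos_sub, ← Real.cos_neg (α - _)]
  rcases hs with rfl | rfl
  · congr 1
    ring
  · rw [← Real.cos_neg]
    congr 1
    ring

lemma wpt_eq_circlePt (n ℓ : ℕ) :
    wpt n ℓ = circlePt ((2 * ℓ + 1) * Real.pi / 2 ^ n + 1 * (Real.pi / 2 ^ n)) := by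
  have h : (2 * ℓ + 2) * Real.pi / 2 ^ n =
      (2 * ℓ + 1) * Real.pi / 2 ^ n + 1 * (Real.pi / 2 ^ n) := by ring
  rw [wpt, h, circlePt]

lemma wpt_pred_eq_circlePt (n ℓ : ℕ) :
    wpt n (ℓ + 2 ^ n - 1) =
      circlePt ((2 * ℓ + 1) * Real.pi / 2 ^ n + -1 * (Real.pi / 2 ^ n)) := by
  have h : (2 * ((ℓ + 2 ^ n - 1 : ℕ) : ℝ) + 2) * Real.pi / 2 ^ n =
      (2 * ℓ + 1) * Real.pi / 2 ^ n + -1 * (Real.pi / 2 ^ n) + 2 * Real.pi := by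
    have h1 : 1 ≤ ℓ + 2 ^ n := le_add_left Nat.one_le_two_pow
    push_cast [Nat.cast_sub h1]
    field_simp
    ring
  rw [wpt, h, Real.cos_add_two_pi, Real.sin_add_two_pi, circlePt]

/-- If `e ⊆ S_ℓ`, then `⟨v_ℓ, p⟩ ≤ 1` for all `p` in the projection of `P^e_n` onto
`(y_1, z_1)`, and the bound is attained at `w_{ℓ-1}` and `w_ℓ` (indices mod `2^n`),
which both lie in that projection. -/
theorem vtx_dot_le_one_on_proj_Pe (n : ℕ) (hn : 2 ≤ n)
    (e : Finset (Fin n)) (he : e.card = 2)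
    (ℓ : ℕ) (hℓ : ℓ < 2 ^ n)
    (b : Fin n → Fin 2) (hb : chainAux n b (vtx n ℓ) n = vtx n 0)
    (hS : ∀ i ∈ e, b i = 0) :
    (∀ p ∈ proj2 '' Pe n e, vtx n ℓ ⬝ᵥ p ≤ 1) ∧
    wpt n (ℓ + 2 ^ n - 1) ∈ proj2 '' Pe n e ∧
    wpt n ℓ ∈ proj2 '' Pe n e ∧
    vtx n ℓ ⬝ᵥ wpt n (ℓ + 2 ^ n - 1) = 1 ∧
    vtx n ℓ ⬝ᵥ wpt n ℓ = 1 := by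
  refine ⟨?_, ?_, ?_, ?_, ?_⟩
  · rintro _ ⟨p, hp, rfl⟩
    exact vtx_dot_proj2_le_one hn hb hS hp
  · rw [wpt_pred_eq_circlePt]
    exact circlePt_mem_proj2_image_Pe hn hb hS (.inr rfl)
  · rw [wpt_eq_circlePt]
    exact circlePt_mem_proj2_image_Pe hn hb hS (.inl rfl)
  · rw [wpt_pred_eq_circlePt]
    exact vtx_dot_circlePt hn ℓ (.inr rfl)
  · rw [wpt_eq_circlePt]
    exact vtx_dot_circlePt hn ℓ (.inl rfl)
end
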